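/- Let Γ : ℝ² → ℝ³ be a smooth map such that each Γ(·,t) is a pseudo-arc parametrized null curve, and suppose its curvature satisfies κ(s,t) = f(s − λt) for a smooth function f and a constant λ ∈ ℝ. Then for each t ∈ ℝ there exist a vector v(t) ∈ ℝ³ and a linear map A(t) : ℝ³ → ℝ³ preserving the Minkowski form, with det A(t) = 1 and preserving the future lightcone, such that Γ(s,t) = v(t) + A(t)·Γ(s − λt, 0) for all s ∈ ℝ; i.e. the curve moves by Lorentzian rigid motions without changing shape. -/

import Mathlib

noncomputable section

/-- The Minkowski bilinear form on `ℝ³`: `⟨x,y⟩ = -(x¹y³ + x³y¹) + x²y²`. -/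
def mink (x y : Fin 3 → ℝ) : ℝ := -(x 0 * y 2 + x 2 * y 0) + x 1 * y 1

/-- Partial derivative in the first (space) variable, vector-valued. -/
def dsV (f : ℝ → ℝ → Fin 3 → ℝ) : ℝ → ℝ → Fin 3 → ℝ := fun s t => deriv (fun x => f x t) s


structure IsFr (T N G : Fin 3 → ℝ) (k : ℝ) : Prop where
  tt : mink T T = 0
  tn : mink T N = 0
  nn : mink N N = 1
  tg : mink T G = -1
  ng : mink N G = 0
  gg : mink G G = 4 * k

def fdet (T N G : Fin 3 → ℝ) : ℝ :=
  T 0 * (N 1 * G 2 - N 2 * G 1) - T 1 * (N 0 * G 2 - N 2 * G 0) + T 2 * (N 0 * G 1 - N 1 * G 0)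

lemma mink_comm' (x y : Fin 3 → ℝ) : mink x y = mink y x := by unfold mink; ring

lemma fdet_sq {T N G : Fin 3 → ℝ} {k : ℝ} (h : IsFr T N G k) : fdet T N G ^ 2 = 1 := by
  have key : fdet T N G ^ 2 = -(mink T T * (mink N N * mink G G - mink N G ^ 2)
      - mink T N * (mink T N * mink G G - mink N G * mink T G)
      + mink T G * (mink T N * mink N G - mink N N * mink T G)) := by
    unfold fdet mink; ring
  rw [key, h.tt, h.tn, h.nn, h.tg, h.ng, h.gg]; ring

lemma fr_zero {T N G : Fin 3 → ℝ} {k : ℝ} (h : IsFr T N G k) (y : Fin 3 → ℝ)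
    (h1 : mink y T = 0) (h2 : mink y N = 0) (h3 : mink y G = 0) : y = 0 := by
  have hd : fdet T N G ≠ 0 := by
    intro h0; have := fdet_sq h; rw [h0] at this; norm_num at this
  have e0 : y 0 * fdet T N G = 0 := by
    have : y 0 * fdet T N G = -(mink y T * (N 0 * G 1 - N 1 * G 0)
      + mink y N * (G 0 * T 1 - G 1 * T 0) + mink y G * (T 0 * N 1 - T 1 * N 0)) := by
      unfold fdet mink; ring
    rw [this, h1, h2, h3]; ring
  have e1 : y 1 * fdet T N G = 0 := by
    have : y 1 * fdet T N G = (mink y T * (N 2 * G 0 - N 0 * G 2)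
      + mink y N * (G 2 * T 0 - G 0 * T 2) + mink y G * (T 2 * N 0 - T 0 * N 2)) := by
      unfold fdet mink; ring
    rw [this, h1, h2, h3]; ring
  have e2 : y 2 * fdet T N G = 0 := by
    have : y 2 * fdet T N G = -(mink y T * (N 1 * G 2 - N 2 * G 1)
      + mink y N * (G 1 * T 2 - G 2 * T 1) + mink y G * (T 1 * N 2 - T 2 * N 1)) := by
      unfold fdet mink; ring
    rw [this, h1, h2, h3]; ring
  ext i
  fin_cases i
  · simpa [hd] using e0
  · simpa [hd] using e1
  · simpa [hd] using e2

lemma mink_lin (a b c : ℝ) (T N G y : Fin 3 → ℝ) :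
    mink (a • T + b • N + c • G) y = a * mink T y + b * mink N y + c * mink G y := by
  simp only [mink, Pi.add_apply, Pi.smul_apply, smul_eq_mul]; ring

lemma mink_sub (x y z : Fin 3 → ℝ) : mink (x - y) z = mink x z - mink y z := by
  simp only [mink, Pi.sub_apply]; ring

lemma fr_expand {T N G : Fin 3 → ℝ} {k : ℝ} (h : IsFr T N G k) (x : Fin 3 → ℝ) :
    x = (-mink x G - 4 * k * mink x T) • T + (mink x N) • N + (-mink x T) • G := by
  rw [← sub_eq_zero]
  have nt := mink_comm' N T
  have gt := mink_comm' G T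
  have gn := mink_comm' G N
  apply fr_zero h
  · rw [mink_sub, mink_lin, nt, gt, h.tt, h.tn, h.tg]; ring
  · rw [mink_sub, mink_lin, gn, h.ng, h.tn, h.nn]; ring
  · rw [mink_sub, mink_lin, h.gg, h.ng, h.tg]; ring

lemma fr_pair {T N G : Fin 3 → ℝ} {k : ℝ} (h : IsFr T N G k) (a b c a' b' c' : ℝ) :
    mink (a • T + b • N + c • G) (a' • T + b' • N + c' • G)
      = -(a * c' + c * a') + b * b' + 4 * k * (c * c') := by
  have nt := mink_comm' N T
  have gt := mink_comm' G T
  have gn := mink_comm' G N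
  rw [mink_lin, mink_comm' T, mink_comm' N, mink_comm' G, mink_lin, mink_lin, mink_lin,
    nt, gt, gn, h.tt, h.tn, h.nn, h.tg, h.ng, h.gg]; ring

/-- the map carrying one frame to the other -/
def frMap (T0 N0 G0 T N G : Fin 3 → ℝ) (k : ℝ) : (Fin 3 → ℝ) →ₗ[ℝ] (Fin 3 → ℝ) where
  toFun x := (-mink x G0 - 4 * k * mink x T0) • T + (mink x N0) • N + (-mink x T0) • G
  map_add' x y := by
    ext i; simp only [mink, Pi.add_apply, Pi.smul_apply, smul_eq_mul]; ring
  map_smul' c x := by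
    ext i; simp only [mink, Pi.add_apply, Pi.smul_apply, smul_eq_mul, RingHom.id_apply]; ring

lemma frMap_apply (T0 N0 G0 T N G : Fin 3 → ℝ) (k : ℝ) (x : Fin 3 → ℝ) :
  frMap T0 N0 G0 T N G k x =
    (-mink x G0 - 4 * k * mink x T0) • T + (mink x N0) • N + (-mink x T0) • G := rfl

lemma frMap_T {T0 N0 G0 : Fin 3 → ℝ} {k : ℝ} (h : IsFr T0 N0 G0 k) (T N G : Fin 3 → ℝ) :
    frMap T0 N0 G0 T N G k T0 = T := by
  rw [frMap_apply, h.tg, h.tt, h.tn]; ext i; simp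

lemma frMap_N {T0 N0 G0 : Fin 3 → ℝ} {k : ℝ} (h : IsFr T0 N0 G0 k) (T N G : Fin 3 → ℝ) :
    frMap T0 N0 G0 T N G k N0 = N := by
  rw [frMap_apply, h.ng, h.nn, mink_comm' N0 T0, h.tn]; ext i; simp

lemma frMap_G {T0 N0 G0 : Fin 3 → ℝ} {k : ℝ} (h : IsFr T0 N0 G0 k) (T N G : Fin 3 → ℝ) :
    frMap T0 N0 G0 T N G k G0 = G := by
  rw [frMap_apply, h.gg, mink_comm' G0 T0, mink_comm' G0 N0, h.tg, h.ng]; ext i; simp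

lemma frMap_isom {T0 N0 G0 T N G : Fin 3 → ℝ} {k : ℝ} (h0 : IsFr T0 N0 G0 k) (h : IsFr T N G k)
    (x y : Fin 3 → ℝ) :
    mink (frMap T0 N0 G0 T N G k x) (frMap T0 N0 G0 T N G k y) = mink x y := by
  rw [frMap_apply, frMap_apply, fr_pair h, ← fr_pair h0, ← fr_expand h0, ← fr_expand h0]

def frMat (T N G : Fin 3 → ℝ) : Matrix (Fin 3) (Fin 3) ℝ := (Matrix.of ![T, N, G]).transpose

lemma frMat_det (T N G : Fin 3 → ℝ) : (frMat T N G).det = fdet T N G := by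
  rw [frMat, Matrix.det_transpose, Matrix.det_fin_three]
  simp [fdet]; ring

lemma frMap_det {T0 N0 G0 T N G : Fin 3 → ℝ} {k : ℝ} (h0 : IsFr T0 N0 G0 k)
    (hd : fdet T N G = fdet T0 N0 G0) : LinearMap.det (frMap T0 N0 G0 T N G k) = 1 := by
  have hne : fdet T0 N0 G0 ≠ 0 := by
    intro h; have := fdet_sq h0; rw [h] at this; norm_num at this
  have hc : (frMap T0 N0 G0 T N G k) ∘ₗ (Matrix.toLin' (frMat T0 N0 G0))
      = Matrix.toLin' (frMat T N G) := by
    refine (Pi.basisFun ℝ (Fin 3)).ext fun j => ?_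
    have c0 : ∀ T N G : Fin 3 → ℝ, Matrix.toLin' (frMat T N G) (Pi.basisFun ℝ (Fin 3) j)
        = ![T, N, G] j := by
      intro T N G
      rw [Pi.basisFun_apply, Matrix.toLin'_apply, Matrix.mulVec_single_one]
      rfl
    rw [LinearMap.comp_apply, c0, c0]
    fin_cases j
    · exact frMap_T h0 T N G
    · exact frMap_N h0 T N G
    · exact frMap_G h0 T N G
  have := congrArg LinearMap.det hc
  rw [LinearMap.det_comp, LinearMap.det_toLin', LinearMap.det_toLin', frMat_det, frMat_det, hd]
    at this
  exact mul_right_cancel₀ hne (by rw [this, one_mul])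

lemma mink_e (x : Fin 3 → ℝ) : mink x ![1, 0, 1] = -(x 0 + x 2) := by
  simp [mink]

lemma fut_pos {u : Fin 3 → ℝ} (hu : mink u u = 0) (hf : mink u ![1, 0, 1] ≤ 0) :
    0 ≤ u 0 ∧ 0 ≤ u 2 := by
  rw [mink_e] at hf
  have h : 2 * (u 0 * u 2) = u 1 ^ 2 := by unfold mink at hu; linarith
  constructor <;> by_contra hc <;> nlinarith [sq_nonneg (u 1), sq_nonneg (u 0), sq_nonneg (u 2)]

lemma fut_neg {z u : Fin 3 → ℝ} (hz : mink z z = 0) (hu : mink u u = 0)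
    (huf : mink u ![1, 0, 1] < 0) (h : mink z u < 0) : mink z ![1, 0, 1] < 0 := by
  by_contra hc
  push Not at hc
  obtain ⟨u0, u2⟩ := fut_pos hu huf.le
  have hz' : mink (-z) (-z) = 0 := by simpa [mink] using hz
  obtain ⟨z0, z2⟩ := fut_pos hz' (by rw [mink_e] at *; simp; linarith)
  simp only [Pi.neg_apply] at z0 z2
  unfold mink at hz hu h
  have a := mul_nonneg z0 u2
  have b := mul_nonneg z2 u0
  have e : (z 1 * u 1) ^ 2 = 4 * ((z 0 * u 2) * (z 2 * u 0)) := by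
    have e1 : z 1 ^ 2 = 2 * (z 0 * z 2) := by linarith
    have e2 : u 1 ^ 2 = 2 * (u 0 * u 2) := by linarith
    rw [mul_pow, e1, e2]; ring
  nlinarith [sq_nonneg (z 0 * u 2 - z 2 * u 0)]

lemma fut_le {x u : Fin 3 → ℝ} (hx : mink x x = 0) (hxf : mink x ![1, 0, 1] < 0)
    (hu : mink u u = 0) (huf : mink u ![1, 0, 1] < 0) : mink x u ≤ 0 := by
  by_contra hc
  have := fut_neg (z := -x) (by simpa [mink] using hx) hu huf
    (by simp only [mink, Pi.neg_apply] at *; linarith)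
  rw [mink_e] at *
  simp only [Pi.neg_apply] at this
  linarith

lemma fut_par {x u : Fin 3 → ℝ} (hx : mink x x = 0) (hxf : mink x ![1, 0, 1] < 0)
    (hu : mink u u = 0) (huf : mink u ![1, 0, 1] < 0) (h : mink x u = 0) :
    ∃ c : ℝ, 0 < c ∧ x = c • u := by
  rw [mink_e] at *
  unfold mink at hx hu h
  have hs : 0 < u 0 + u 2 := by linarith
  have e1 : x 1 ^ 2 = 2 * (x 0 * x 2) := by linarith
  have e2 : u 1 ^ 2 = 2 * (u 0 * u 2) := by linarith
  have e3 : x 1 * u 1 = x 0 * u 2 + x 2 * u 0 := by linarith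
  have e4 : x 0 * u 2 - x 2 * u 0 = 0 := by
    have : (x 1 * u 1) ^ 2 = 4 * ((x 0 * u 2) * (x 2 * u 0)) := by
      rw [mul_pow, e1, e2]; ring
    rw [e3] at this
    have : (x 0 * u 2 - x 2 * u 0) ^ 2 = 0 := by linarith
    exact pow_eq_zero_iff (two_ne_zero) |>.1 this
  obtain ⟨c, hc⟩ : ∃ c, c = (x 0 + x 2) / (u 0 + u 2) := ⟨_, rfl⟩
  have hcp : 0 < c := by rw [hc]; apply div_pos <;> linarith
  have hc' : c * (u 0 + u 2) = x 0 + x 2 := by rw [hc]; field_simp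
  have x0 : x 0 = c * u 0 := by
    apply mul_right_cancel₀ hs.ne'
    linear_combination e4 - u 0 * hc'
  have x2 : x 2 = c * u 2 := by linarith
  have x1 : x 1 = c * u 1 := by
    have : (x 1 - c * u 1) ^ 2 = 0 := by
      rw [x0, x2] at e3 e1
      linear_combination e1 + c ^ 2 * e2 - 2 * c * e3
    have := pow_eq_zero_iff (two_ne_zero) |>.1 this
    linarith
  refine ⟨c, hcp, ?_⟩
  ext i; fin_cases i
  · exact x0
  · exact x1
  · exact x2

lemma cone_pres (A : (Fin 3 → ℝ) →ₗ[ℝ] (Fin 3 → ℝ)) (hA : ∀ x y, mink (A x) (A y) = mink x y)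
    (u : Fin 3 → ℝ) (hu : mink u u = 0) (huf : mink u ![1, 0, 1] < 0)
    (hAu : mink (A u) ![1, 0, 1] < 0) (x : Fin 3 → ℝ) (hx : mink x x = 0)
    (hxf : mink x ![1, 0, 1] < 0) : mink (A x) ![1, 0, 1] < 0 := by
  rcases (fut_le hx hxf hu huf).lt_or_eq with h | h
  · exact fut_neg (u := A u) (by rw [hA, hx]) (by rw [hA, hu]) hAu (by rwa [hA])
  · obtain ⟨c, hc, rfl⟩ := fut_par hx hxf hu huf h
    rw [map_smul, mink_e]
    rw [mink_e] at hAu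
    simp only [Pi.smul_apply, smul_eq_mul]
    nlinarith

lemma mink_deriv {x y : ℝ → Fin 3 → ℝ} {x' y' : Fin 3 → ℝ} {s : ℝ}
    (hx : HasDerivAt x x' s) (hy : HasDerivAt y y' s) :
    HasDerivAt (fun s => mink (x s) (y s)) (mink x' (y s) + mink (x s) y') s := by
  rw [hasDerivAt_pi] at hx hy
  unfold mink
  refine ((((hx 0).fun_mul (hy 2)).fun_add ((hx 2).fun_mul (hy 0))).fun_neg.fun_add
    ((hx 1).fun_mul (hy 1))).congr_deriv ?_
  ring

lemma mink_const {x y : ℝ → Fin 3 → ℝ} {x' y' : Fin 3 → ℝ} {s c : ℝ}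
    (hx : HasDerivAt x x' s) (hy : HasDerivAt y y' s) (h : ∀ s, mink (x s) (y s) = c) :
    mink x' (y s) + mink (x s) y' = 0 := by
  have h1 := mink_deriv hx hy
  have h2 : (fun s => mink (x s) (y s)) = fun _ => c := funext h
  rw [h2] at h1
  exact h1.unique (hasDerivAt_const s c)

structure IsCrv (γ T N G H : ℝ → Fin 3 → ℝ) (k : ℝ → ℝ) : Prop where
  dγ : ∀ s, HasDerivAt γ (T s) s
  dT : ∀ s, HasDerivAt T (N s) s
  dN : ∀ s, HasDerivAt N (G s) s
  dG : ∀ s, HasDerivAt G (H s) s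
  tt : ∀ s, mink (T s) (T s) = 0
  nn : ∀ s, mink (N s) (N s) = 1
  gg : ∀ s, mink (G s) (G s) = 4 * k s

lemma IsCrv.tn {γ T N G H : ℝ → Fin 3 → ℝ} {k : ℝ → ℝ} (h : IsCrv γ T N G H k) (s : ℝ) :
    mink (T s) (N s) = 0 := by
  have := mink_const (h.dT s) (h.dT s) h.tt
  rw [mink_comm' (N s)] at this; linarith

lemma IsCrv.tg {γ T N G H : ℝ → Fin 3 → ℝ} {k : ℝ → ℝ} (h : IsCrv γ T N G H k) (s : ℝ) :
    mink (T s) (G s) = -1 := by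
  have := mink_const (h.dT s) (h.dN s) h.tn
  rw [h.nn] at this; linarith

lemma IsCrv.ng {γ T N G H : ℝ → Fin 3 → ℝ} {k : ℝ → ℝ} (h : IsCrv γ T N G H k) (s : ℝ) :
    mink (N s) (G s) = 0 := by
  have := mink_const (h.dN s) (h.dN s) h.nn
  rw [mink_comm' (G s)] at this; linarith

lemma IsCrv.fr {γ T N G H : ℝ → Fin 3 → ℝ} {k : ℝ → ℝ} (h : IsCrv γ T N G H k) (s : ℝ) :
    IsFr (T s) (N s) (G s) (k s) := ⟨h.tt s, h.tn s, h.nn s, h.tg s, h.ng s, h.gg s⟩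

lemma IsCrv.H_eq {γ T N G H : ℝ → Fin 3 → ℝ} {k : ℝ → ℝ} (h : IsCrv γ T N G H k)
    {k' s : ℝ} (hk : HasDerivAt k k' s) :
    H s = (-2 * k') • T s + (-4 * k s) • N s := by
  have ht := mink_const (h.dT s) (h.dG s) h.tg
  have hn := mink_const (h.dN s) (h.dG s) h.ng
  have hg : mink (H s) (G s) + mink (G s) (H s) = 4 * k' := by
    have h1 := mink_deriv (h.dG s) (h.dG s)
    rw [funext h.gg] at h1
    exact h1.unique (hk.const_mul 4)
  rw [mink_comm' (G s)] at hg
  rw [h.ng, mink_comm' (T s)] at ht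
  rw [h.gg, mink_comm' (N s)] at hn
  rw [fr_expand (h.fr s) (H s)]
  have e1 : mink (H s) (T s) = 0 := by linarith
  have e2 : mink (H s) (N s) = -4 * k s := by linarith
  have e3 : mink (H s) (G s) = 2 * k' := by linarith
  rw [e1, e2, e3]
  ext i; simp

lemma frMap_const {γ T N G H γ0 T0 N0 G0 H0 : ℝ → Fin 3 → ℝ} {k k' : ℝ → ℝ}
    (h : IsCrv γ T N G H k) (h0 : IsCrv γ0 T0 N0 G0 H0 k) (hk : ∀ s, HasDerivAt k (k' s) s)
    (x : Fin 3 → ℝ) (s : ℝ) :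
    frMap (T0 s) (N0 s) (G0 s) (T s) (N s) (G s) (k s) x =
    frMap (T0 0) (N0 0) (G0 0) (T 0) (N 0) (G 0) (k 0) x := by
  have key : ∀ s, HasDerivAt
      (fun s => frMap (T0 s) (N0 s) (G0 s) (T s) (N s) (G s) (k s) x) 0 s := by
    intro s
    simp only [frMap_apply]
    have dT0 := mink_deriv (hasDerivAt_const s x) (h0.dT s)
    have dN0 := mink_deriv (hasDerivAt_const s x) (h0.dN s)
    have dG0 := mink_deriv (hasDerivAt_const s x) (h0.dG s)
    have D := ((((dG0.fun_neg).fun_sub (((hk s).const_mul 4).fun_mul dT0)).fun_smul (h.dT s)).fun_add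
      (dN0.fun_smul (h.dN s))).fun_add ((dT0.fun_neg).fun_smul (h.dG s))
    refine D.congr_deriv ?_
    rw [h.H_eq (hk s), h0.H_eq (hk s)]
    ext i
    simp only [mink, Pi.add_apply, Pi.smul_apply, smul_eq_mul, Pi.zero_apply]
    ring
  exact is_const_of_deriv_eq_zero (fun s => (key s).differentiableAt) (fun s => (key s).deriv) s 0

lemma crv_main {γ T N G H γ0 T0 N0 G0 H0 : ℝ → Fin 3 → ℝ} {k k' : ℝ → ℝ}
    (h : IsCrv γ T N G H k) (h0 : IsCrv γ0 T0 N0 G0 H0 k) (hk : ∀ s, HasDerivAt k (k' s) s)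
    (hd : fdet (T 0) (N 0) (G 0) = fdet (T0 0) (N0 0) (G0 0))
    (hf : mink (T 0) ![1, 0, 1] < 0) (hf0 : mink (T0 0) ![1, 0, 1] < 0) :
    ∃ v : Fin 3 → ℝ, ∃ A : (Fin 3 → ℝ) →ₗ[ℝ] (Fin 3 → ℝ),
      (∀ x y, mink (A x) (A y) = mink x y) ∧
      LinearMap.det A = 1 ∧
      (∀ x : Fin 3 → ℝ, x ≠ 0 → mink x x = 0 → mink x ![1, 0, 1] < 0 →
        mink (A x) ![1, 0, 1] < 0) ∧
      (∀ s : ℝ, γ s = v + A (γ0 s)) := by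
  obtain ⟨A, hA⟩ : ∃ A, A = frMap (T0 0) (N0 0) (G0 0) (T 0) (N 0) (G 0) (k 0) := ⟨_, rfl⟩
  have iso : ∀ x y, mink (A x) (A y) = mink x y := by
    rw [hA]; exact frMap_isom (h0.fr 0) (h.fr 0)
  have AT : ∀ s, A (T0 s) = T s := by
    intro s
    rw [hA, ← frMap_const h h0 hk (T0 s) s, frMap_T (h0.fr s)]
  refine ⟨γ 0 - A (γ0 0), A, iso, ?_, ?_, ?_⟩
  · rw [hA]; exact frMap_det (h0.fr 0) hd
  · intro x _ hx hxf
    exact cone_pres A iso (T0 0) (h0.tt 0) hf0 (by rwa [AT]) x hx hxf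
  · have key : ∀ s, HasDerivAt (fun s => γ s - A (γ0 s)) 0 s := by
      intro s
      have := (LinearMap.toContinuousLinearMap A).hasFDerivAt.comp_hasDerivAt s (h0.dγ s)
      refine ((h.dγ s).fun_sub this).congr_deriv ?_
      simp [AT]
    intro s
    have := is_const_of_deriv_eq_zero (fun s => (key s).differentiableAt)
      (fun s => (key s).deriv) s 0
    rw [← this]; abel

lemma dsV_has {F : ℝ → ℝ → Fin 3 → ℝ}
    (hF : ContDiff ℝ (⊤ : ℕ∞) (fun p : ℝ × ℝ => F p.1 p.2)) (s t : ℝ) :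
    HasDerivAt (fun x => F x t) (fderiv ℝ (fun p : ℝ × ℝ => F p.1 p.2) (s, t) (1, 0)) s := by
  have h1 : HasFDerivAt (fun p : ℝ × ℝ => F p.1 p.2) _ (s, t) :=
    (hF.differentiable (by simp) (s, t)).hasFDerivAt
  exact h1.comp_hasDerivAt (f := fun x : ℝ => (x, t)) s
    ((hasDerivAt_id s).prodMk (hasDerivAt_const s t))

lemma dsV_has' {F : ℝ → ℝ → Fin 3 → ℝ}
    (hF : ContDiff ℝ (⊤ : ℕ∞) (fun p : ℝ × ℝ => F p.1 p.2)) (s t : ℝ) :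
    HasDerivAt (fun x => F x t) (dsV F s t) s :=
  (dsV_has hF s t).differentiableAt.hasDerivAt

lemma dsV_smooth {F : ℝ → ℝ → Fin 3 → ℝ}
    (hF : ContDiff ℝ (⊤ : ℕ∞) (fun p : ℝ × ℝ => F p.1 p.2)) :
    ContDiff ℝ (⊤ : ℕ∞) (fun p : ℝ × ℝ => dsV F p.1 p.2) := by
  have : (fun p : ℝ × ℝ => dsV F p.1 p.2)
      = fun p => fderiv ℝ (fun p : ℝ × ℝ => F p.1 p.2) p (1, 0) := by
    ext1 p
    exact (dsV_has hF p.1 p.2).deriv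
  rw [this]
  exact (hF.fderiv_right (by simp)).clm_apply contDiff_const

lemma sign_const {g : ℝ × ℝ → ℝ} (hg : Continuous g) (h : ∀ p, g p ^ 2 = 1) (p q : ℝ × ℝ) :
    g p = g q := by
  have hz : ∀ p q, ¬ (g p ≤ 0 ∧ 0 ≤ g q) := by
    rintro p q ⟨h1, h2⟩
    obtain ⟨r, hr⟩ := mem_range_of_exists_le_of_exists_ge hg ⟨p, h1⟩ ⟨q, h2⟩
    have := h r; rw [hr] at this; norm_num at this
  have hpq := hz p q
  have hqp := hz q p
  rcases (by simpa using h p : g p = 1 ∨ g p = -1) with h1 | h1 <;>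
  rcases (by simpa using h q : g q = 1 ∨ g q = -1) with h2 | h2 <;>
  rw [h1, h2] at hpq hqp ⊢ <;>
  first | (norm_num at hqp; done) | (norm_num at hpq; done)

/-- a motion of pseudo-arc parametrized null curves whose curvature is a
traveling wave `κ(s,t) = f(s - λt)` moves by Lorentzian rigid motions: for each `t`
there is a restricted Poincaré transformation `x ↦ v(t) + A(t)x` with
`Γ(s,t) = v(t) + A(t)·Γ(s - λt, 0)`. -/
theorem stmt16 (Γ : ℝ → ℝ → Fin 3 → ℝ)
    (hΓ : ContDiff ℝ (⊤ : ℕ∞) (fun p : ℝ × ℝ => Γ p.1 p.2))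
    (hnull : ∀ s t : ℝ, mink (dsV Γ s t) (dsV Γ s t) = 0)
    (hfut : ∀ s t : ℝ, mink (dsV Γ s t) ![1, 0, 1] < 0)
    (hpa : ∀ s t : ℝ, mink (dsV (dsV Γ) s t) (dsV (dsV Γ) s t) = 1)
    (κ : ℝ → ℝ → ℝ)
    (hκ : ∀ s t, κ s t = (1/4) * mink (dsV (dsV (dsV Γ)) s t) (dsV (dsV (dsV Γ)) s t))
    (f : ℝ → ℝ) (hf : ContDiff ℝ (⊤ : ℕ∞) f) (lam : ℝ)
    (htw : ∀ s t : ℝ, κ s t = f (s - lam * t)) :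
    ∀ t : ℝ, ∃ v : Fin 3 → ℝ, ∃ A : (Fin 3 → ℝ) →ₗ[ℝ] (Fin 3 → ℝ),
      (∀ x y, mink (A x) (A y) = mink x y) ∧
      LinearMap.det A = 1 ∧
      (∀ x : Fin 3 → ℝ, x ≠ 0 → mink x x = 0 → mink x ![1, 0, 1] < 0 →
        mink (A x) ![1, 0, 1] < 0) ∧
      (∀ s : ℝ, Γ s t = v + A (Γ (s - lam * t) 0)) := by
  intro t
  have h1 := dsV_smooth hΓ
  have h2 := dsV_smooth h1
  have h3 := dsV_smooth h2
  have hk : ∀ s, HasDerivAt (fun s => f (s - lam * t)) (deriv f (s - lam * t)) s := by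
    intro s
    have := (hf.differentiable (by simp) (s - lam * t)).hasDerivAt
    exact HasDerivAt.comp_sub_const s (lam * t) this
  have hg : ∀ s t, mink (dsV (dsV (dsV Γ)) s t) (dsV (dsV (dsV Γ)) s t)
      = 4 * f (s - lam * t) := by
    intro s t; rw [← htw, hκ]; ring
  have c1 : ∀ t, IsCrv (fun s => Γ s t) (fun s => dsV Γ s t) (fun s => dsV (dsV Γ) s t)
      (fun s => dsV (dsV (dsV Γ)) s t) (fun s => dsV (dsV (dsV (dsV Γ))) s t)
      (fun s => f (s - lam * t)) := fun t =>
    ⟨fun s => dsV_has' hΓ s t, fun s => dsV_has' h1 s t, fun s => dsV_has' h2 s t,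
      fun s => dsV_has' h3 s t, fun s => hnull s t, fun s => hpa s t, fun s => hg s t⟩
  have c0 : IsCrv (fun s => Γ (s - lam * t) 0) (fun s => dsV Γ (s - lam * t) 0)
      (fun s => dsV (dsV Γ) (s - lam * t) 0)
      (fun s => dsV (dsV (dsV Γ)) (s - lam * t) 0)
      (fun s => dsV (dsV (dsV (dsV Γ))) (s - lam * t) 0)
      (fun s => f (s - lam * t)) :=
    ⟨fun s => (dsV_has' hΓ _ 0).comp_sub_const s (lam * t),
      fun s => (dsV_has' h1 _ 0).comp_sub_const s (lam * t),
      fun s => (dsV_has' h2 _ 0).comp_sub_const s (lam * t),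
      fun s => (dsV_has' h3 _ 0).comp_sub_const s (lam * t),
      fun s => hnull _ 0, fun s => hpa _ 0, fun s => by simpa using hg (s - lam * t) 0⟩
  refine crv_main (c1 t) c0 hk ?_ (hfut 0 t) (hfut _ 0)
  have i1 := fun i => (continuous_apply i).comp h1.continuous
  have i2 := fun i => (continuous_apply i).comp h2.continuous
  have i3 := fun i => (continuous_apply i).comp h3.continuous
  have hc : Continuous (fun p : ℝ × ℝ =>
      fdet (dsV Γ p.1 p.2) (dsV (dsV Γ) p.1 p.2) (dsV (dsV (dsV Γ)) p.1 p.2)) := by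
    simp only [Function.comp_def] at i1 i2 i3
    unfold fdet
    exact (((i1 0).mul (((i2 1).mul (i3 2)).sub ((i2 2).mul (i3 1)))).sub
      ((i1 1).mul (((i2 0).mul (i3 2)).sub ((i2 2).mul (i3 0))))).add
      ((i1 2).mul (((i2 0).mul (i3 1)).sub ((i2 1).mul (i3 0))))
  exact sign_const hc (fun p => fdet_sq ((c1 p.2).fr p.1)) (0, t) (0 - lam * t, 0)
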